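/- There exist universal constants C > 0 and ε₀ > 0 such that: if f is a (1+ε)-biLipschitz self map of ℍ with ε ≤ ε₀ and f(O) = O, and for some r > 0 and k ∈ ℕ one has d(f(z;t), (z;t)) ≤ C ε^{1/2^k} r for all (z;t) ∈ B(O,r), then ∫_{B(O, C⁻¹r)} ‖Jf(x,y,t) − I‖ dx dy dt ≤ C ε^{1/2^{k+1}} r⁴, where Jf is the a.e.-defined Pansu Jacobian matrix of f and I is the 2×2 identity matrix. -/

import Mathlib

noncomputable section

open MeasureTheory

/-- Points of the Heisenberg group `ℍ`, identified with `ℝ³ ≅ ℂ × ℝ`: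
`(x, y, t)` corresponds to `(z ; t)` with `z = x + iy`. -/
abbrev H : Type := ℝ × ℝ × ℝ

/-- The Heisenberg group law
`(x,y,t)·(x',y',t') = (x+x', y+y', t+t'+2(x'y − xy'))`. -/
def Hmul (p q : H) : H :=
  (p.1 + q.1, p.2.1 + q.2.1, p.2.2 + q.2.2 + 2 * (q.1 * p.2.1 - p.1 * q.2.1))

/-- The Heisenberg group inverse. -/
def Hinv (p : H) : H := (-p.1, -p.2.1, -p.2.2)

/-- The identity `O = (0,0,0)`. -/
def HO : H := (0, 0, 0)

/-- The control (Carnot–Carathéodory) distance: the infimum of the lengths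
`∫₀¹ √(a(s)² + b(s)²) ds` of horizontal Lipschitz curves `γ` joining `P` to `Q`,
i.e. curves satisfying a.e. `γ' = a·X(γ) + b·Y(γ)` where `X = ∂ₓ + 2y∂_t` and
`Y = ∂_y − 2x∂_t`. -/
def dH (P Q : H) : ℝ :=
  sInf { L : ℝ | ∃ (γ : ℝ → H) (a b : ℝ → ℝ) (K : NNReal),
    LipschitzWith K γ ∧ γ 0 = P ∧ γ 1 = Q ∧
    (∀ᵐ s ∂volume, s ∈ Set.Icc (0:ℝ) 1 →
      HasDerivAt γ (a s, b s, 2 * (γ s).2.1 * a s - 2 * (γ s).1 * b s) s) ∧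
    IntervalIntegrable (fun s => Real.sqrt (a s ^ 2 + b s ^ 2)) volume 0 1 ∧
    L = ∫ s in (0:ℝ)..1, Real.sqrt (a s ^ 2 + b s ^ 2) }

/-- `γ : ℝ → ℍ` is a `(1+ε)`-quasigeodesic. -/
def IsQuasiGeodesic (ε : ℝ) (γ : ℝ → H) : Prop :=
  ∀ s s' : ℝ, (1 + ε)⁻¹ * |s - s'| ≤ dH (γ s) (γ s') ∧
    dH (γ s) (γ s') ≤ (1 + ε) * |s - s'|

/-- `f : ℍ → ℍ` is `(1+ε)`-biLipschitz for the control distance. -/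
def IsBiLip (ε : ℝ) (f : H → H) : Prop :=
  ∀ P Q : H, (1 + ε)⁻¹ * dH P Q ≤ dH (f P) (f Q) ∧ dH (f P) (f Q) ≤ (1 + ε) * dH P Q

/-- `(a,b)` is the horizontal speed of `γ`: a.e. `γ'(s) = a(s)X(γ(s)) + b(s)Y(γ(s))`. -/
def HasHorizSpeed (γ : ℝ → H) (a b : ℝ → ℝ) : Prop :=
  ∀ᵐ s ∂volume, HasDerivAt γ (a s, b s, 2 * (γ s).2.1 * a s - 2 * (γ s).1 * b s) s

/-- The Heisenberg dilation `δ_λ(z;t) = (λz; λ²t)`. -/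
def Hdil (l : ℝ) (p : H) : H := (l * p.1, l * p.2.1, l ^ 2 * p.2.2)

/-- `f` is Pansu differentiable at `P` with Pansu Jacobian the `2×2` matrix `A`:
`δ_{1/σ}(f(P)⁻¹ · f(P · δ_σ(u,v,w)))` converges, as `σ → 0⁺` and uniformly on
compact sets of `(u,v,w)`, to `(A(u,v); det(A)·w)`. -/
def HasPansuJacobianAt (f : H → H) (A : Matrix (Fin 2) (Fin 2) ℝ) (P : H) : Prop :=
  ∀ K : Set H, IsCompact K → ∀ δ : ℝ, 0 < δ → ∃ σ₀ > (0:ℝ), ∀ σ : ℝ, 0 < σ → σ < σ₀ →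
    ∀ Q ∈ K,
      dist (Hdil σ⁻¹ (Hmul (Hinv (f P)) (f (Hmul P (Hdil σ Q)))))
        ((A 0 0 * Q.1 + A 0 1 * Q.2.1, A 1 0 * Q.1 + A 1 1 * Q.2.1,
          A.det * Q.2.2) : H) < δ

/-- The operator norm of a `2×2` real matrix (acting on Euclidean `ℝ²`). -/
def matOpNorm (A : Matrix (Fin 2) (Fin 2) ℝ) : ℝ :=
  sSup { r : ℝ | ∃ x y : ℝ, x ^ 2 + y ^ 2 ≤ 1 ∧
    r = Real.sqrt ((A 0 0 * x + A 0 1 * y) ^ 2 + (A 1 0 * x + A 1 1 * y) ^ 2) }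

def HLen (P Q : H) : Set ℝ := { L : ℝ | ∃ (γ : ℝ → H) (a b : ℝ → ℝ) (K : NNReal),
    LipschitzWith K γ ∧ γ 0 = P ∧ γ 1 = Q ∧
    (∀ᵐ s ∂volume, s ∈ Set.Icc (0:ℝ) 1 →
      HasDerivAt γ (a s, b s, 2 * (γ s).2.1 * a s - 2 * (γ s).1 * b s) s) ∧
    IntervalIntegrable (fun s => Real.sqrt (a s ^ 2 + b s ^ 2)) volume 0 1 ∧
    L = ∫ s in (0:ℝ)..1, Real.sqrt (a s ^ 2 + b s ^ 2) }

theorem dH_eq (P Q : H) : dH P Q = sInf (HLen P Q) := rfl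

theorem ftc_lip {g h : ℝ → ℝ} {K : NNReal} {a b : ℝ} (hab : a ≤ b) (hg : LipschitzWith K g)
    (hd : ∀ᵐ s ∂volume, s ∈ Set.Icc a b → HasDerivAt g (h s) s) :
    IntervalIntegrable h volume a b ∧ ∫ s in a..b, h s = g b - g a := by
  have hac : AbsolutelyContinuousOnInterval g a b :=
    (hg.lipschitzOnWith (s := Set.uIcc a b)).absolutelyContinuousOnInterval
  have h1 := hac.intervalIntegrable_deriv
  have h2 := hac.integral_deriv_eq_sub
  have he : ∀ᵐ s ∂volume, s ∈ Set.uIoc a b → deriv g s = h s := by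
    filter_upwards [hd] with s hs hm
    rw [Set.uIoc_of_le hab] at hm
    exact (hs ⟨hm.1.le, hm.2⟩).deriv
  refine ⟨h1.congr_ae ((ae_restrict_iff' measurableSet_uIoc).2 he), ?_⟩
  rw [← h2]
  exact (intervalIntegral.integral_congr_ae he).symm

theorem hfst {E F : Type*} [NormedAddCommGroup E] [NormedSpace ℝ E] [NormedAddCommGroup F]
    [NormedSpace ℝ F] {γ : ℝ → E × F} {p : E × F} {s : ℝ} (h : HasDerivAt γ p s) :
    HasDerivAt (fun x => (γ x).1) p.1 s :=
  (ContinuousLinearMap.fst ℝ E F).hasFDerivAt.comp_hasDerivAt s h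

theorem hsnd {E F : Type*} [NormedAddCommGroup E] [NormedSpace ℝ E] [NormedAddCommGroup F]
    [NormedSpace ℝ F] {γ : ℝ → E × F} {p : E × F} {s : ℝ} (h : HasDerivAt γ p s) :
    HasDerivAt (fun x => (γ x).2) p.2 s :=
  (ContinuousLinearMap.snd ℝ E F).hasFDerivAt.comp_hasDerivAt s h

theorem lin_le {u v a b : ℝ} : u * a + v * b ≤ √(u ^ 2 + v ^ 2) * √(a ^ 2 + b ^ 2) := by
  rw [← Real.sqrt_mul (by positivity)]
  apply Real.le_sqrt_of_sq_le
  nlinarith [sq_nonneg (u * b - v * a)]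

theorem HLen_nonneg {P Q : H} {L : ℝ} (h : L ∈ HLen P Q) : 0 ≤ L := by
  obtain ⟨γ, a, b, K, -, -, -, -, -, rfl⟩ := h
  exact intervalIntegral.integral_nonneg (by norm_num) fun _ _ => Real.sqrt_nonneg _

theorem bdd (P Q : H) : BddBelow (HLen P Q) := ⟨0, fun _ h => HLen_nonneg h⟩

theorem dH_nonneg (P Q : H) : 0 ≤ dH P Q := Real.sInf_nonneg fun _ h => HLen_nonneg h

theorem curve_proj {γ : ℝ → H} {a b : ℝ → ℝ} {K : NNReal} (hL : LipschitzWith K γ)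
    (hd : ∀ᵐ s ∂volume, s ∈ Set.Icc (0:ℝ) 1 →
      HasDerivAt γ (a s, b s, 2 * (γ s).2.1 * a s - 2 * (γ s).1 * b s) s)
    (hi : IntervalIntegrable (fun s => Real.sqrt (a s ^ 2 + b s ^ 2)) volume 0 1)
    (u v s : ℝ) (hs : s ∈ Set.Icc (0:ℝ) 1) :
    u * ((γ s).1 - (γ 0).1) + v * ((γ s).2.1 - (γ 0).2.1) ≤
      √(u ^ 2 + v ^ 2) * ∫ s in (0:ℝ)..1, Real.sqrt (a s ^ 2 + b s ^ 2) := by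
  have hx : LipschitzWith (1 * K) (fun s => (γ s).1) := LipschitzWith.prod_fst.comp hL
  have hy : LipschitzWith (1 * (1 * K)) (fun s => (γ s).2.1) :=
    LipschitzWith.prod_fst.comp (LipschitzWith.prod_snd.comp hL)
  have hg : LipschitzWith _ (fun s => u * (γ s).1 + v * (γ s).2.1) :=
    ((lipschitzWith_smul u).comp hx).add ((lipschitzWith_smul v).comp hy)
  have hd' : ∀ᵐ τ ∂volume, τ ∈ Set.Icc (0:ℝ) s →
      HasDerivAt (fun s => u * (γ s).1 + v * (γ s).2.1) (u * a τ + v * b τ) τ := by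
    filter_upwards [hd] with τ h hm
    have h := h ⟨hm.1, hm.2.trans hs.2⟩
    exact ((hfst h).const_mul u).add ((hfst (hsnd h)).const_mul v)
  obtain ⟨i1, i2⟩ := ftc_lip hs.1 hg hd'
  have hi' : IntervalIntegrable (fun s => Real.sqrt (a s ^ 2 + b s ^ 2)) volume 0 s :=
    hi.mono_set (by rw [Set.uIcc_of_le hs.1, Set.uIcc_of_le zero_le_one]
                    exact Set.Icc_subset_Icc_right hs.2)
  calc _ = ∫ τ in (0:ℝ)..s, (u * a τ + v * b τ) := by rw [i2]; ring
    _ ≤ ∫ τ in (0:ℝ)..s, √(u ^ 2 + v ^ 2) * √(a τ ^ 2 + b τ ^ 2) :=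
        intervalIntegral.integral_mono_on hs.1 i1 (hi'.const_mul _) fun _ _ => lin_le
    _ = √(u ^ 2 + v ^ 2) * ∫ τ in (0:ℝ)..s, √(a τ ^ 2 + b τ ^ 2) := by
        rw [intervalIntegral.integral_const_mul]
    _ ≤ _ := by
        gcongr
        exact intervalIntegral.integral_mono_interval le_rfl hs.1 hs.2
          (Filter.Eventually.of_forall fun _ => Real.sqrt_nonneg _) hi

theorem HLen_proj {P Q : H} {L : ℝ} (h : L ∈ HLen P Q) (u v : ℝ) :
    u * (Q.1 - P.1) + v * (Q.2.1 - P.2.1) ≤ √(u ^ 2 + v ^ 2) * L := by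
  obtain ⟨γ, a, b, K, hL, rfl, rfl, hd, hi, rfl⟩ := h
  exact curve_proj hL hd hi u v 1 ⟨zero_le_one, le_rfl⟩

theorem HLen_t {P : H} {L : ℝ} (h : L ∈ HLen HO P) : |P.2.2| ≤ 4 * L ^ 2 := by
  have hL0 := HLen_nonneg h
  obtain ⟨γ, a, b, K, hL, h0, rfl, hd, hi, hLe⟩ := h
  have key : ∀ s ∈ Set.Icc (0:ℝ) 1, |(γ s).1| ≤ L ∧ |(γ s).2.1| ≤ L := by
    intro s hs
    have h1 := curve_proj hL hd hi 1 0 s hs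
    have h2 := curve_proj hL hd hi (-1) 0 s hs
    have h3 := curve_proj hL hd hi 0 1 s hs
    have h4 := curve_proj hL hd hi 0 (-1) s hs
    rw [← hLe, h0] at h1 h2 h3 h4
    norm_num [HO] at h1 h2 h3 h4
    exact ⟨abs_le.2 ⟨by linarith, by linarith⟩, abs_le.2 ⟨by linarith, by linarith⟩⟩
  have ht : LipschitzWith (1 * (1 * K)) (fun s => (γ s).2.2) :=
    LipschitzWith.prod_snd.comp (LipschitzWith.prod_snd.comp hL)
  obtain ⟨i1, i2⟩ := ftc_lip (h := fun s => 2 * (γ s).2.1 * a s - 2 * (γ s).1 * b s)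
    zero_le_one ht (by filter_upwards [hd] with s h hm using hsnd (hsnd (h hm)))
  rw [h0] at i2
  have : (γ 1).2.2 = ∫ s in (0:ℝ)..1, (2 * (γ s).2.1 * a s - 2 * (γ s).1 * b s) := by
    rw [i2]; simp [HO]
  rw [this]
  calc _ ≤ ∫ s in (0:ℝ)..1, |2 * (γ s).2.1 * a s - 2 * (γ s).1 * b s| :=
        intervalIntegral.abs_integral_le_integral_abs zero_le_one
    _ ≤ ∫ s in (0:ℝ)..1, (4 * L) * √(a s ^ 2 + b s ^ 2) := by
        apply intervalIntegral.integral_mono_on zero_le_one i1.abs (hi.const_mul _)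
        intro s hs
        obtain ⟨k1, k2⟩ := key s hs
        have e1 : |a s| ≤ √(a s ^ 2 + b s ^ 2) := Real.abs_le_sqrt (by nlinarith [sq_nonneg (b s)])
        have e2 : |b s| ≤ √(a s ^ 2 + b s ^ 2) := Real.abs_le_sqrt (by nlinarith [sq_nonneg (a s)])
        calc _ ≤ |2 * (γ s).2.1 * a s| + |2 * (γ s).1 * b s| := abs_sub _ _
          _ = 2 * |(γ s).2.1| * |a s| + 2 * |(γ s).1| * |b s| := by simp [abs_mul]
          _ ≤ 2 * L * √(a s ^ 2 + b s ^ 2) + 2 * L * √(a s ^ 2 + b s ^ 2) := by gcongr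
          _ = _ := by ring
    _ = 4 * L ^ 2 := by rw [intervalIntegral.integral_const_mul, ← hLe]; ring

theorem curve_exists (P : H) (u v w ρ : ℝ) (hρ : 0 < ρ) (hu : |u| ≤ ρ) (hv : |v| ≤ ρ)
    (hw : |w| ≤ 8 * ρ ^ 2) : ∃ L ∈ HLen P (Hmul P (u, v, w)), L ≤ 68 * ρ := by
  obtain ⟨p1, p2, p3⟩ := P
  set β : ℝ := 15 * w / (2 * ρ) + 5 * v with hβ
  have hβb : |β| ≤ 65 * ρ := by
    calc |β| ≤ |15 * w / (2 * ρ)| + |5 * v| := abs_add_le _ _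
      _ = 15 * |w| / (2 * ρ) + 5 * |v| := by
          rw [abs_div, abs_of_pos (by positivity : 0 < 2 * ρ), abs_mul, abs_mul]; norm_num
      _ ≤ 15 * (8 * ρ ^ 2) / (2 * ρ) + 5 * ρ := by gcongr
      _ = 65 * ρ := by field_simp; ring
  let X : ℝ → ℝ := fun s => u * s + ρ * (s - s ^ 2)
  let Y : ℝ → ℝ := fun s => v * s + β * (s - 3 * s ^ 2 + 2 * s ^ 3)
  let T : ℝ → ℝ := fun s => 2 * (-ρ * v * s ^ 3 / 3 + u * β * (s ^ 3 - s ^ 4) +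
    ρ * β * (2 * s ^ 3 / 3 - s ^ 4 + 2 * s ^ 5 / 5))
  let a : ℝ → ℝ := fun s => u + ρ * (1 - 2 * s)
  let b : ℝ → ℝ := fun s => v + β * (1 - 6 * s + 6 * s ^ 2)
  let g : ℝ → H := fun s => (p1 + X s, p2 + Y s, p3 + T s + 2 * (X s * p2 - p1 * Y s))
  have hX : ∀ s, HasDerivAt X (a s) s := by
    intro s
    have := ((hasDerivAt_id s).const_mul u).add (((hasDerivAt_id s).sub
      (hasDerivAt_pow 2 s)).const_mul ρ)
    exact this.congr_deriv (by simp [a])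
  have hY : ∀ s, HasDerivAt Y (b s) s := by
    intro s
    have := ((hasDerivAt_id s).const_mul v).add ((((hasDerivAt_id s).sub
      ((hasDerivAt_pow 2 s).const_mul 3)).add ((hasDerivAt_pow 3 s).const_mul 2)).const_mul β)
    exact this.congr_deriv (by simp only [b]; push_cast; ring)
  have hT : ∀ s, HasDerivAt T (2 * Y s * a s - 2 * X s * b s) s := by
    intro s
    have := ((((hasDerivAt_pow 3 s).const_mul (-ρ * v)).div_const 3).add
      (((hasDerivAt_pow 3 s).sub (hasDerivAt_pow 4 s)).const_mul (u * β)) |>.add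
      ((((((hasDerivAt_pow 3 s).const_mul 2).div_const 3).sub (hasDerivAt_pow 4 s)).add
        (((hasDerivAt_pow 5 s).const_mul 2).div_const 5)).const_mul (ρ * β))).const_mul 2
    exact this.congr_deriv (by simp [a, b, X, Y]; ring)
  have hg : ∀ s, HasDerivAt g (a s, b s, 2 * (g s).2.1 * a s - 2 * (g s).1 * b s) s := by
    intro s
    have := ((hX s).const_add p1).prodMk (((hY s).const_add p2).prodMk
      (((hT s).const_add p3).add ((((hX s).mul_const p2).sub ((hY s).const_mul p1)).const_mul 2)))
    exact this.congr_deriv (by simp [g]; ring)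
  have hgc : ContDiff ℝ 1 g := by
    simp only [g, X, Y, T]; fun_prop
  obtain ⟨K, hK⟩ := hgc.contDiffOn.exists_lipschitzOnWith one_ne_zero (convex_Icc (0:ℝ) 1)
    isCompact_Icc
  let c : ℝ → ℝ := fun s => (Set.projIcc (0:ℝ) 1 zero_le_one s : ℝ)
  have hc1 : ∀ s ∈ Set.Icc (0:ℝ) 1, c s = s := fun s hs => by simp [c, Set.projIcc_of_mem _ hs]
  have hcl : LipschitzWith 1 c := by
    have := LipschitzWith.subtype_val (Set.Icc (0:ℝ) 1) |>.comp
      (LipschitzWith.projIcc (zero_le_one (α := ℝ)))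
    rw [mul_one] at this
    exact this
  have hlen : ∫ s in (0:ℝ)..1, √(a s ^ 2 + b s ^ 2) ≤ 68 * ρ := by
    have : ∫ s in (0:ℝ)..1, √(a s ^ 2 + b s ^ 2) ≤ ∫ s in (0:ℝ)..1, 68 * ρ := by
      apply intervalIntegral.integral_mono_on zero_le_one
      · apply Continuous.intervalIntegrable; simp only [a, b]; fun_prop
      · simp
      · intro s hs
        have e1 : |a s| ≤ 2 * ρ := by
          have : |1 - 2 * s| ≤ 1 := abs_le.2 ⟨by linarith [hs.2], by linarith [hs.1]⟩
          calc |a s| ≤ |u| + |ρ * (1 - 2 * s)| := abs_add_le _ _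
            _ = |u| + ρ * |1 - 2 * s| := by rw [abs_mul, abs_of_pos hρ]
            _ ≤ ρ + ρ * 1 := by gcongr
            _ = _ := by ring
        have e2 : |b s| ≤ 66 * ρ := by
          have : |1 - 6 * s + 6 * s ^ 2| ≤ 1 :=
            abs_le.2 ⟨by nlinarith [sq_nonneg (2 * s - 1)], by nlinarith [hs.1, hs.2]⟩
          calc |b s| ≤ |v| + |β * (1 - 6 * s + 6 * s ^ 2)| := abs_add_le _ _
            _ = |v| + |β| * |1 - 6 * s + 6 * s ^ 2| := by rw [abs_mul]
            _ ≤ ρ + 65 * ρ * 1 := by gcongr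
            _ = _ := by ring
        rw [Real.sqrt_le_left (by positivity)]
        have e3 := sq_le_sq' (by linarith [abs_nonneg (a s)]) e1
        have e4 := sq_le_sq' (by linarith [abs_nonneg (b s)]) e2
        rw [sq_abs] at e3 e4
        nlinarith
    simpa using this
  refine ⟨_, ⟨g ∘ c, a, b, K * 1, ?_, ?_, ?_, ?_, ?_, rfl⟩, hlen⟩
  · rw [← lipschitzOnWith_univ]
    exact hK.comp hcl.lipschitzOnWith fun s _ => (Set.projIcc (0:ℝ) 1 zero_le_one s).2
  · simp [g, X, Y, T, hc1 0 (by simp)]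
  · simp only [Function.comp, hc1 1 (by simp), g, X, Y, T, Hmul]
    refine Prod.ext (by simp) (Prod.ext (by simp; right; norm_num) ?_)
    simp only [hβ]
    field_simp
    ring
  · have h0 : ∀ᵐ s : ℝ ∂volume, s ≠ 0 ∧ s ≠ 1 := by
      filter_upwards [Measure.ae_ne volume 0, Measure.ae_ne volume 1] with s h1 h2 using ⟨h1, h2⟩
    filter_upwards [h0] with s hs hm
    have e : (g ∘ c) =ᶠ[nhds s] g := by
      filter_upwards [Ioo_mem_nhds (lt_of_le_of_ne hm.1 hs.1.symm) (lt_of_le_of_ne hm.2 hs.2)]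
        with τ hτ
      simp [hc1 τ ⟨hτ.1.le, hτ.2.le⟩]
    rw [Function.comp, hc1 s hm]
    exact (hg s).congr_of_eventuallyEq e
  · apply Continuous.intervalIntegrable; simp only [a, b]; fun_prop

theorem Hmul_inv_cancel (P Q : H) : Hmul P (Hmul (Hinv P) Q) = Q := by
  obtain ⟨a, b, c⟩ := P
  obtain ⟨x, y, t⟩ := Q
  refine Prod.ext ?_ (Prod.ext ?_ ?_) <;> simp [Hmul, Hinv] <;> ring

theorem HLen_nonempty (P Q : H) : (HLen P Q).Nonempty := by
  rcases h : Hmul (Hinv P) Q with ⟨u, v, w⟩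
  have hu := abs_nonneg u
  have hv := abs_nonneg v
  have hw := abs_nonneg w
  obtain ⟨L, hL, -⟩ := curve_exists P u v w (1 + |u| + |v| + |w|) (by positivity)
    (by linarith) (by linarith) (by nlinarith)
  rw [← h, Hmul_inv_cancel] at hL
  exact ⟨L, hL⟩

theorem dH_proj (P Q : H) (u v : ℝ) :
    u * (Q.1 - P.1) + v * (Q.2.1 - P.2.1) ≤ √(u ^ 2 + v ^ 2) * dH P Q := by
  rcases (Real.sqrt_nonneg (u ^ 2 + v ^ 2)).eq_or_lt with h | h
  · obtain ⟨L, hL⟩ := HLen_nonempty P Q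
    have := HLen_proj hL u v
    rw [← h] at this ⊢
    linarith
  · rw [mul_comm (√(u ^ 2 + v ^ 2)), ← div_le_iff₀ h]
    refine le_csInf (HLen_nonempty P Q) fun L hL => ?_
    rw [div_le_iff₀ h, mul_comm L]
    exact HLen_proj hL u v

theorem ball_box {P : H} {ρ : ℝ} (h : dH HO P < ρ) :
    |P.1| ≤ ρ ∧ |P.2.1| ≤ ρ ∧ |P.2.2| ≤ 4 * ρ ^ 2 := by
  obtain ⟨L, hL, hlt⟩ := exists_lt_of_csInf_lt (HLen_nonempty HO P) h
  have h0 := HLen_nonneg hL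
  have h1 := HLen_proj hL 1 0
  have h2 := HLen_proj hL (-1) 0
  have h3 := HLen_proj hL 0 1
  have h4 := HLen_proj hL 0 (-1)
  norm_num [HO] at h1 h2 h3 h4
  refine ⟨abs_le.2 ⟨by linarith, by linarith⟩, abs_le.2 ⟨by linarith, by linarith⟩, ?_⟩
  exact (HLen_t hL).trans (by gcongr)

theorem box_ball {P : H} {ρ : ℝ} (hρ : 0 < ρ) (h1 : |P.1| ≤ ρ) (h2 : |P.2.1| ≤ ρ)
    (h3 : |P.2.2| ≤ 8 * ρ ^ 2) : dH HO P ≤ 68 * ρ := by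
  obtain ⟨L, hL, hle⟩ := curve_exists HO P.1 P.2.1 P.2.2 ρ hρ h1 h2 h3
  have : Hmul HO (P.1, P.2.1, P.2.2) = P := by simp [Hmul, HO]
  rw [this] at hL
  exact (csInf_le (bdd _ _) hL).trans hle

theorem dH_line (P : H) (u v : ℝ) : dH P (Hmul P (u, v, 0)) ≤ √(u ^ 2 + v ^ 2) := by
  have hlin : ∀ s : ℝ, HasDerivAt (fun s : ℝ => Hmul P (s * u, s * v, 0))
      (u, v, 2 * (u * P.2.1 - P.1 * v)) s := by
    intro s
    have hu : HasDerivAt (fun s : ℝ => s * u) u s := by simpa using (hasDerivAt_id s).mul_const u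
    have hv : HasDerivAt (fun s : ℝ => s * v) v s := by simpa using (hasDerivAt_id s).mul_const v
    exact (hu.const_add P.1).prodMk ((hv.const_add P.2.1).prodMk
      ((((hu.mul_const P.2.1).sub (hv.const_mul P.1)).const_mul 2).const_add (P.2.2 + 0)))
  refine csInf_le (bdd _ _) ⟨fun s => Hmul P (s * u, s * v, 0), fun _ => u, fun _ => v,
    ‖((u, v, 2 * (u * P.2.1 - P.1 * v)) : H)‖₊, ?_, ?_, ?_, ?_, ?_, ?_⟩
  · refine lipschitzWith_of_nnnorm_deriv_le (fun s => (hlin s).differentiableAt) fun s => ?_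
    rw [(hlin s).deriv]
  · simp [Hmul]
  · simp
  · refine Filter.Eventually.of_forall fun s _ => ?_
    convert hlin s using 3
    simp [Hmul]; ring
  · simp
  · simp

theorem pansu_tendsto {f : H → H} {A : Matrix (Fin 2) (Fin 2) ℝ} {P : H}
    (h : HasPansuJacobianAt f A P) (u v : ℝ) :
    Filter.Tendsto (fun σ : ℝ => σ⁻¹ * ((f (Hmul P (σ * u, σ * v, 0))).1 - (f P).1))
      (nhdsWithin 0 (Set.Ioi 0)) (nhds (A 0 0 * u + A 0 1 * v)) ∧
    Filter.Tendsto (fun σ : ℝ => σ⁻¹ * ((f (Hmul P (σ * u, σ * v, 0))).2.1 - (f P).2.1))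
      (nhdsWithin 0 (Set.Ioi 0)) (nhds (A 1 0 * u + A 1 1 * v)) := by
  have key : ∀ δ > 0, ∀ᶠ σ in nhdsWithin (0:ℝ) (Set.Ioi 0),
      dist (Hdil σ⁻¹ (Hmul (Hinv (f P)) (f (Hmul P (σ * u, σ * v, 0)))))
        ((A 0 0 * u + A 0 1 * v, A 1 0 * u + A 1 1 * v, A.det * 0) : H) < δ := by
    intro δ hδ
    obtain ⟨σ₀, h0, hσ⟩ := h {(u, v, 0)} isCompact_singleton δ hδ
    filter_upwards [Ioo_mem_nhdsGT h0] with σ hs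
    have := hσ σ hs.1 hs.2 (u, v, 0) rfl
    simpa [Hdil] using this
  constructor
  · rw [Metric.tendsto_nhds]
    intro δ hδ
    filter_upwards [key δ hδ] with σ hs
    rw [Prod.dist_eq] at hs
    have := (le_max_left _ _).trans_lt hs
    simpa [Hdil, Hmul, Hinv, neg_add_eq_sub] using this
  · rw [Metric.tendsto_nhds]
    intro δ hδ
    filter_upwards [key δ hδ] with σ hs
    rw [Prod.dist_eq, Prod.dist_eq] at hs
    have := ((le_max_left _ _).trans (le_max_right _ _)).trans_lt hs
    simpa [Hdil, Hmul, Hinv, neg_add_eq_sub] using this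

theorem sqrt_scale {σ u v : ℝ} (hu : u ^ 2 + v ^ 2 = 1) : √((σ * u) ^ 2 + (σ * v) ^ 2) = |σ| := by
  rw [← Real.sqrt_sq_eq_abs]; congr 1; linear_combination σ ^ 2 * hu

theorem pansu_bound {f : H → H} {A : Matrix (Fin 2) (Fin 2) ℝ} {P : H} {ε : ℝ} (hε : 0 ≤ ε)
    (hf : IsBiLip ε f) (h : HasPansuJacobianAt f A P) {u v : ℝ} (huv : u ^ 2 + v ^ 2 = 1)
    (p q : ℝ) :
    p * (A 0 0 * u + A 0 1 * v) + q * (A 1 0 * u + A 1 1 * v) ≤ √(p ^ 2 + q ^ 2) * (1 + ε) := by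
  obtain ⟨h1, h2⟩ := pansu_tendsto h u v
  refine le_of_tendsto ((h1.const_mul p).add (h2.const_mul q)) ?_
  filter_upwards [self_mem_nhdsWithin] with σ hσ
  have hσ : 0 < σ := hσ
  have e1 := dH_proj (f P) (f (Hmul P (σ * u, σ * v, 0))) p q
  have e2 := (hf P (Hmul P (σ * u, σ * v, 0))).2
  have e3 := dH_line P (σ * u) (σ * v)
  rw [sqrt_scale huv, abs_of_pos hσ] at e3
  have e4 : dH (f P) (f (Hmul P (σ * u, σ * v, 0))) ≤ (1 + ε) * σ :=
    e2.trans (by gcongr)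
  calc _ = σ⁻¹ * (p * ((f (Hmul P (σ * u, σ * v, 0))).1 - (f P).1) +
        q * ((f (Hmul P (σ * u, σ * v, 0))).2.1 - (f P).2.1)) := by ring
    _ ≤ σ⁻¹ * (√(p ^ 2 + q ^ 2) * ((1 + ε) * σ)) := by
        gcongr; exact e1.trans (by gcongr)
    _ = _ := by field_simp

def qf (A : Matrix (Fin 2) (Fin 2) ℝ) (u v : ℝ) : ℝ :=
  u * (A 0 0 * u + A 0 1 * v) + v * (A 1 0 * u + A 1 1 * v)

theorem qf_bound {f : H → H} {A : Matrix (Fin 2) (Fin 2) ℝ} {P : H} {ε : ℝ} (hε : 0 ≤ ε)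
    (hf : IsBiLip ε f) (h : HasPansuJacobianAt f A P) {u v : ℝ} (huv : u ^ 2 + v ^ 2 = 1) :
    |qf A u v| ≤ 1 + ε := by
  have h1 := pansu_bound hε hf h huv u v
  have h2 := pansu_bound hε hf h huv (-u) (-v)
  rw [huv, Real.sqrt_one] at h1
  rw [neg_sq, neg_sq, huv, Real.sqrt_one] at h2
  exact abs_le.2 ⟨by unfold qf; linarith, by unfold qf; linarith⟩

theorem col_bound {f : H → H} {A : Matrix (Fin 2) (Fin 2) ℝ} {P : H} {ε : ℝ} (hε : 0 ≤ ε)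
    (hf : IsBiLip ε f) (h : HasPansuJacobianAt f A P) {u v : ℝ} (huv : u ^ 2 + v ^ 2 = 1) :
    (A 0 0 * u + A 0 1 * v) ^ 2 + (A 1 0 * u + A 1 1 * v) ^ 2 ≤ (1 + ε) ^ 2 := by
  have h1 := pansu_bound hε hf h huv (A 0 0 * u + A 0 1 * v) (A 1 0 * u + A 1 1 * v)
  set s := (A 0 0 * u + A 0 1 * v) ^ 2 + (A 1 0 * u + A 1 1 * v) ^ 2 with hs
  have h0 : 0 ≤ s := by positivity
  have h2 : √s * √s = s := Real.mul_self_sqrt h0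
  have h3 := Real.sqrt_nonneg s
  have h4 : √s * √s ≤ √s * (1 + ε) := by linarith
  nlinarith

theorem line_est {f : H → H} {ε : ℝ} (hε : 0 ≤ ε) (hf : IsBiLip ε f)
    {J : H → Matrix (Fin 2) (Fin 2) ℝ} (P : H) {u v : ℝ} (huv : u ^ 2 + v ^ 2 = 1)
    (hJ : ∀ᵐ s : ℝ, HasPansuJacobianAt f (J (Hmul P (s * u, s * v, 0))) (Hmul P (s * u, s * v, 0)))
    {ρ D : ℝ} (hρ : 0 < ρ)
    (h1 : dH (f (Hmul P (ρ * u, ρ * v, 0))) (Hmul P (ρ * u, ρ * v, 0)) ≤ D)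
    (h2 : dH (f (Hmul P (-ρ * u, -ρ * v, 0))) (Hmul P (-ρ * u, -ρ * v, 0)) ≤ D) :
    IntervalIntegrable (fun s : ℝ => qf (J (Hmul P (s * u, s * v, 0))) u v) volume (-ρ) ρ ∧
    2 * ρ - 2 * D ≤ ∫ s in (-ρ)..ρ, qf (J (Hmul P (s * u, s * v, 0))) u v := by
  have hadd : ∀ s σ : ℝ, Hmul (Hmul P (s * u, s * v, 0)) (σ * u, σ * v, 0) =
      Hmul P ((s + σ) * u, (s + σ) * v, 0) := by
    intro s σ
    refine Prod.ext ?_ (Prod.ext ?_ ?_) <;> simp only [Hmul] <;> ring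
  let g : ℝ → ℝ := fun s => u * (f (Hmul P (s * u, s * v, 0))).1 +
    v * (f (Hmul P (s * u, s * v, 0))).2.1
  have hg : LipschitzWith ⟨1 + ε, by linarith⟩ g := by
    refine LipschitzWith.of_le_add_mul _ fun s s' => ?_
    have e1 := dH_proj (f (Hmul P (s' * u, s' * v, 0))) (f (Hmul P (s * u, s * v, 0))) u v
    rw [huv, Real.sqrt_one, one_mul] at e1
    have e2 := (hf (Hmul P (s' * u, s' * v, 0)) (Hmul P (s * u, s * v, 0))).2
    have e3 := dH_line (Hmul P (s' * u, s' * v, 0)) ((s - s') * u) ((s - s') * v)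
    rw [hadd, sqrt_scale huv, add_sub_cancel] at e3
    have e4 : (1 + ε) * dH (Hmul P (s' * u, s' * v, 0)) (Hmul P (s * u, s * v, 0)) ≤
      (1 + ε) * |s - s'| := by gcongr
    change g s ≤ g s' + (1 + ε) * dist s s'
    rw [Real.dist_eq]
    simp only [g]
    linarith
  have hd : ∀ᵐ s : ℝ, s ∈ Set.Icc (-ρ) ρ →
      HasDerivAt g (qf (J (Hmul P (s * u, s * v, 0))) u v) s := by
    filter_upwards [hJ, hg.ae_differentiableAt_real] with s hs hdiff _
    have hr : HasDerivWithinAt g (qf (J (Hmul P (s * u, s * v, 0))) u v) (Set.Ioi s) s := by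
      obtain ⟨t1, t2⟩ := pansu_tendsto hs u v
      have t3 := (t1.const_mul u).add (t2.const_mul v)
      rw [hasDerivWithinAt_iff_tendsto_slope' (by simp)]
      have t4 : Filter.Tendsto (fun x : ℝ => x - s) (nhdsWithin s (Set.Ioi s))
          (nhdsWithin 0 (Set.Ioi 0)) := by
        refine tendsto_nhdsWithin_iff.2 ⟨?_, ?_⟩
        · have : Filter.Tendsto (fun x : ℝ => x - s) (nhds s) (nhds (s - s)) :=
            (continuous_id.sub continuous_const).tendsto s
          rw [sub_self] at this
          exact this.mono_left nhdsWithin_le_nhds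
        · filter_upwards [self_mem_nhdsWithin] with x hx using sub_pos.2 (Set.mem_Ioi.1 hx)
      refine (t3.comp t4).congr fun x => ?_
      simp only [Function.comp, hadd, add_sub_cancel, slope_def_field, g]
      ring
    have := (uniqueDiffWithinAt_Ioi s).eq_deriv _ hr hdiff.hasDerivAt.hasDerivWithinAt
    rw [this]
    exact hdiff.hasDerivAt
  obtain ⟨i1, i2⟩ := ftc_lip (by linarith) hg hd
  refine ⟨i1, ?_⟩
  rw [i2]
  have a1 := dH_proj (f (Hmul P (ρ * u, ρ * v, 0))) (Hmul P (ρ * u, ρ * v, 0)) u v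
  have a2 := dH_proj (f (Hmul P (-ρ * u, -ρ * v, 0))) (Hmul P (-ρ * u, -ρ * v, 0)) (-u) (-v)
  rw [huv, Real.sqrt_one, one_mul] at a1
  rw [neg_sq, neg_sq, huv, Real.sqrt_one, one_mul] at a2
  have b1 : (Hmul P (ρ * u, ρ * v, 0)).1 = P.1 + ρ * u := rfl
  have b2 : (Hmul P (ρ * u, ρ * v, 0)).2.1 = P.2.1 + ρ * v := rfl
  have b3 : (Hmul P (-ρ * u, -ρ * v, 0)).1 = P.1 + -ρ * u := rfl
  have b4 : (Hmul P (-ρ * u, -ρ * v, 0)).2.1 = P.2.1 + -ρ * v := rfl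
  rw [b1, b2] at a1
  rw [b3, b4] at a2
  simp only [g]
  have : ρ * (u ^ 2 + v ^ 2) = ρ := by rw [huv, mul_one]
  nlinarith

theorem main_dir {f : H → H} {ε : ℝ} (hε : 0 ≤ ε) (hf : IsBiLip ε f)
    {J : H → Matrix (Fin 2) (Fin 2) ℝ} (hm : ∀ i j : Fin 2, Measurable fun P : H => J P i j)
    (hJ : ∀ᵐ P ∂volume, HasPansuJacobianAt f (J P) P)
    {u v : ℝ} (huv : u ^ 2 + v ^ 2 = 1) (E : (ℝ × ℝ) × ℝ → H) (hE : MeasurePreserving E)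
    (base : ℝ × ℝ → H) (hb : ∀ w s, E (w, s) = Hmul (base w) (s * u, s * v, 0))
    {ρ D : ℝ} (hρ : 0 < ρ) (Bx : Set H) (hBx : MeasurableSet Bx)
    (hpre : E ⁻¹' Bx = (Set.Icc (-ρ) ρ ×ˢ Set.Icc (-(6 * ρ ^ 2)) (6 * ρ ^ 2)) ×ˢ Set.Icc (-ρ) ρ)
    (hD : ∀ P ∈ Bx, dH (f P) P ≤ D) (c0 c1 : ℝ) (hc1 : 0 ≤ c1) :
    IntegrableOn (fun P => c0 + c1 * (1 - qf (J P) u v)) Bx ∧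
    ∫ P in Bx, (c0 + c1 * (1 - qf (J P) u v)) ≤ 24 * ρ ^ 3 * (2 * ρ * c0 + c1 * (2 * D)) := by
  set S : Set (ℝ × ℝ) := Set.Icc (-ρ) ρ ×ˢ Set.Icc (-(6 * ρ ^ 2)) (6 * ρ ^ 2) with hS
  have hSm : MeasurableSet S := measurableSet_Icc.prod measurableSet_Icc
  have hSv : volume S = ENNReal.ofReal (24 * ρ ^ 3) := by
    rw [hS, Measure.volume_eq_prod, Measure.prod_prod, Real.volume_Icc, Real.volume_Icc,
      ← ENNReal.ofReal_mul (by linarith)]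
    congr 1; ring
  have hqm : Measurable fun P => c0 + c1 * (1 - qf (J P) u v) := by
    unfold qf
    have := hm 0 0
    have := hm 0 1
    have := hm 1 0
    have := hm 1 1
    fun_prop
  have hfin : volume Bx < ⊤ := by
    rw [← hE.measure_preimage hBx.nullMeasurableSet, hpre, Measure.volume_eq_prod,
      Measure.prod_prod, hSv, Real.volume_Icc]
    exact ENNReal.mul_lt_top ENNReal.ofReal_lt_top ENNReal.ofReal_lt_top
  have hint : IntegrableOn (fun P => c0 + c1 * (1 - qf (J P) u v)) Bx := by
    refine Measure.integrableOn_of_bounded (M := |c0| + c1 * (1 + (1 + ε))) hfin.ne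
      hqm.aestronglyMeasurable ?_
    refine ae_restrict_of_ae ?_
    filter_upwards [hJ] with P hP
    have := qf_bound hε hf hP huv
    calc ‖c0 + c1 * (1 - qf (J P) u v)‖ ≤ |c0| + |c1 * (1 - qf (J P) u v)| := abs_add_le _ _
      _ = |c0| + c1 * |1 - qf (J P) u v| := by rw [abs_mul, abs_of_nonneg hc1]
      _ ≤ |c0| + c1 * (|1| + |qf (J P) u v|) := by gcongr; exact abs_sub _ _
      _ ≤ _ := by rw [abs_one]; gcongr
  refine ⟨hint, ?_⟩
  have hint2 : IntegrableOn (fun z => c0 + c1 * (1 - qf (J (E z)) u v))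
      (S ×ˢ Set.Icc (-ρ) ρ) (volume.prod volume) := by
    rw [← hpre]
    have h1 := hint
    unfold IntegrableOn at h1 ⊢
    exact (hE.restrict_preimage hBx).integrable_comp_of_integrable h1
  have heq : ∫ P in Bx, (c0 + c1 * (1 - qf (J P) u v)) =
      ∫ w in S, ∫ s in Set.Icc (-ρ) ρ, (c0 + c1 * (1 - qf (J (E (w, s))) u v)) := by
    conv_lhs => rw [← hE.map_eq]
    rw [setIntegral_map hBx hqm.aestronglyMeasurable hE.measurable.aemeasurable, hpre,
      Measure.volume_eq_prod, setIntegral_prod _ hint2]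
  rw [heq]
  have hae : ∀ᵐ w : ℝ × ℝ, ∀ᵐ s : ℝ, HasPansuJacobianAt f (J (E (w, s))) (E (w, s)) := by
    have := hE.quasiMeasurePreserving.ae hJ
    rw [Measure.volume_eq_prod] at this
    exact Measure.ae_ae_of_ae_prod this
  have hline : ∀ᵐ w : ℝ × ℝ, w ∈ S →
      ∫ s in Set.Icc (-ρ) ρ, (c0 + c1 * (1 - qf (J (E (w, s))) u v)) ≤
        2 * ρ * c0 + c1 * (2 * D) := by
    filter_upwards [hae] with w hw hwS
    have hmem : ∀ s ∈ Set.Icc (-ρ) ρ, E (w, s) ∈ Bx := by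
      intro s hs
      have : (w, s) ∈ E ⁻¹' Bx := by rw [hpre]; exact ⟨hwS, hs⟩
      exact this
    have m1 := hD _ (hmem ρ ⟨by linarith, le_rfl⟩)
    have m2 := hD _ (hmem (-ρ) ⟨le_rfl, by linarith⟩)
    simp only [hb] at hw m1 m2 ⊢
    obtain ⟨l1, l2⟩ := line_est hε hf (base w) huv hw hρ m1 m2
    rw [integral_Icc_eq_integral_Ioc, ← intervalIntegral.integral_of_le (by linarith),
      intervalIntegral.integral_add (by simp) (((by simp : IntervalIntegrable (fun _ : ℝ => (1:ℝ))
        volume (-ρ) ρ).sub l1).const_mul c1), intervalIntegral.integral_const_mul,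
      intervalIntegral.integral_sub (by simp) l1]
    simp only [intervalIntegral.integral_const, smul_eq_mul]
    have : c1 * ((ρ - -ρ) * 1 - ∫ s in (-ρ)..ρ, qf (J (Hmul (base w) (s * u, s * v, 0))) u v) ≤
        c1 * (2 * D) := by
      gcongr; linarith
    linarith
  calc _ ≤ ∫ w in S, (2 * ρ * c0 + c1 * (2 * D)) := by
        refine setIntegral_mono_on_ae ?_ ?_ hSm hline
        · have h1 := hint2
          unfold IntegrableOn at h1
          rw [← Measure.prod_restrict] at h1
          exact h1.integral_prod_left
        · exact integrableOn_const (by rw [hSv]; exact ENNReal.ofReal_ne_top)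
    _ = _ := by
        rw [setIntegral_const, Measure.real, hSv, ENNReal.toReal_ofReal (by positivity),
          smul_eq_mul]

theorem mp_shear (c : ℝ) : MeasurePreserving
    (fun z : (ℝ × ℝ) × ℝ => ((z.2, z.1.1, z.1.2 + c * (z.1.1 * z.2)) : ℝ × ℝ × ℝ)) := by
  have h1 : MeasurePreserving (Prod.swap : (ℝ × ℝ) × ℝ → ℝ × (ℝ × ℝ)) volume volume :=
    Measure.measurePreserving_swap
  have h2 : MeasurePreserving (fun p : ℝ × (ℝ × ℝ) => (id p.1, (fun (s : ℝ) (q : ℝ × ℝ) =>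
      (q.1, q.2 + c * (q.1 * s))) p.1 p.2)) volume volume := by
    refine MeasurePreserving.skew_product (f := id) (g := fun (s : ℝ) (q : ℝ × ℝ) =>
      (q.1, q.2 + c * (q.1 * s))) (μa := (volume : Measure ℝ))
      (μc := (volume : Measure (ℝ × ℝ))) (μd := (volume : Measure (ℝ × ℝ)))
      (MeasurePreserving.id (volume : Measure ℝ)) ?_ ?_
    · unfold Function.uncurry; fun_prop
    · refine Filter.Eventually.of_forall fun s => ?_
      refine MeasurePreserving.map_eq (MeasurePreserving.skew_product (f := id)
        (g := fun (a b : ℝ) => b + c * (a * s)) (μa := (volume : Measure ℝ))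
        (μc := (volume : Measure ℝ)) (μd := (volume : Measure ℝ))
        (MeasurePreserving.id (volume : Measure ℝ)) ?_ ?_)
      · unfold Function.uncurry; fun_prop
      · exact Filter.Eventually.of_forall fun a => (measurePreserving_add_right volume _).map_eq
  exact h2.comp h1

theorem mp_perm : MeasurePreserving
    (fun z : ℝ × ℝ × ℝ => ((z.2.1, z.1, z.2.2) : ℝ × ℝ × ℝ)) := by
  have h1 := (volume_preserving_prodAssoc (α₁ := ℝ) (β₁ := ℝ) (γ₁ := ℝ))
  have h2 : MeasurePreserving (Prod.swap : ℝ × ℝ → ℝ × ℝ) volume volume :=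
    Measure.measurePreserving_swap
  exact h1.comp ((h2.prod (MeasurePreserving.id (volume : Measure ℝ))).comp (h1.symm _))

theorem matOpNorm_nonneg (A : Matrix (Fin 2) (Fin 2) ℝ) : 0 ≤ matOpNorm A := by
  refine Real.sSup_nonneg ?_
  rintro r ⟨x, y, -, rfl⟩
  exact Real.sqrt_nonneg _

theorem matOpNorm_le (A : Matrix (Fin 2) (Fin 2) ℝ) :
    matOpNorm A ≤ √(A 0 0 ^ 2 + A 0 1 ^ 2 + A 1 0 ^ 2 + A 1 1 ^ 2) := by
  refine csSup_le ⟨_, 0, 0, by norm_num, rfl⟩ ?_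
  rintro r ⟨x, y, h, rfl⟩
  apply Real.sqrt_le_sqrt
  have h1 : (A 0 0 * x + A 0 1 * y) ^ 2 ≤ (A 0 0 ^ 2 + A 0 1 ^ 2) * (x ^ 2 + y ^ 2) := by
    nlinarith [sq_nonneg (A 0 0 * y - A 0 1 * x)]
  have h2 : (A 1 0 * x + A 1 1 * y) ^ 2 ≤ (A 1 0 ^ 2 + A 1 1 ^ 2) * (x ^ 2 + y ^ 2) := by
    nlinarith [sq_nonneg (A 1 0 * y - A 1 1 * x)]
  have h3 := mul_le_mul_of_nonneg_left h (by positivity : 0 ≤ A 0 0 ^ 2 + A 0 1 ^ 2)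
  have h4 := mul_le_mul_of_nonneg_left h (by positivity : 0 ≤ A 1 0 ^ 2 + A 1 1 ^ 2)
  linarith

theorem sqrt_amgm {F κ : ℝ} (hF : 0 ≤ F) (hκ : 0 < κ) : √F ≤ κ / 2 + F / (2 * κ) := by
  have h : κ / 2 + F / (2 * κ) - √F = (κ - √F) ^ 2 / (2 * κ) := by
    field_simp
    nlinarith [Real.sq_sqrt hF]
  have : 0 ≤ (κ - √F) ^ 2 / (2 * κ) := by positivity
  linarith

theorem core {f : H → H} {ε : ℝ} (hε : 0 ≤ ε) (hε1 : ε ≤ 1) (hf : IsBiLip ε f)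
    {J : H → Matrix (Fin 2) (Fin 2) ℝ} (hm : ∀ i j : Fin 2, Measurable fun P : H => J P i j)
    (hJ : ∀ᵐ P ∂volume, HasPansuJacobianAt f (J P) P) {r D : ℝ} (hr : 0 < r)
    (hD : ∀ P : H, dH HO P < r → dH (f P) P ≤ D) {κ : ℝ} (hκ : 0 < κ) :
    ∫ P in {P : H | dH HO P < (100:ℝ)⁻¹ * r}, matOpNorm (J P - 1) ≤
      48 * (r / 100) ^ 3 * (2 * (r / 100) * (κ / 4 + 3 * ε / (2 * κ)) + κ⁻¹ * (2 * D)) := by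
  set ρ := r / 100 with hρd
  have hρ : 0 < ρ := by positivity
  have hball : {P : H | dH HO P < (100:ℝ)⁻¹ * r} = {P : H | dH HO P < ρ} := by
    ext P; simp [hρd, div_eq_inv_mul]
  rw [hball]
  let B1 : Set H := {P | |P.1| ≤ ρ ∧ |P.2.1| ≤ ρ ∧ |P.2.2 - 2 * (P.2.1 * P.1)| ≤ 6 * ρ ^ 2}
  let B2 : Set H := {P | |P.1| ≤ ρ ∧ |P.2.1| ≤ ρ ∧ |P.2.2 + 2 * (P.1 * P.2.1)| ≤ 6 * ρ ^ 2}
  have hB1 : MeasurableSet B1 := by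
    have m1 : MeasurableSet {P : H | |P.1| ≤ ρ} :=
      (isClosed_le (by fun_prop) (by fun_prop)).measurableSet
    have m2 : MeasurableSet {P : H | |P.2.1| ≤ ρ} :=
      (isClosed_le (by fun_prop) (by fun_prop)).measurableSet
    have m3 : MeasurableSet {P : H | |P.2.2 - 2 * (P.2.1 * P.1)| ≤ 6 * ρ ^ 2} :=
      (isClosed_le (by fun_prop) (by fun_prop)).measurableSet
    exact m1.inter (m2.inter m3)
  have hB2 : MeasurableSet B2 := by
    have m1 : MeasurableSet {P : H | |P.1| ≤ ρ} :=
      (isClosed_le (by fun_prop) (by fun_prop)).measurableSet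
    have m2 : MeasurableSet {P : H | |P.2.1| ≤ ρ} :=
      (isClosed_le (by fun_prop) (by fun_prop)).measurableSet
    have m3 : MeasurableSet {P : H | |P.2.2 + 2 * (P.1 * P.2.1)| ≤ 6 * ρ ^ 2} :=
      (isClosed_le (by fun_prop) (by fun_prop)).measurableSet
    exact m1.inter (m2.inter m3)
  have hxy : ∀ x y : ℝ, |x| ≤ ρ → |y| ≤ ρ → |2 * (x * y)| ≤ 2 * ρ ^ 2 := by
    intro x y hx hy
    rw [abs_mul, abs_mul, abs_two]
    have := mul_le_mul hx hy (abs_nonneg _) hρ.le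
    nlinarith
  have hD1 : ∀ P ∈ B1, dH (f P) P ≤ D := by
    rintro P ⟨h1, h2, h3⟩
    have h4 := hxy _ _ h2 h1
    refine hD P ((box_ball hρ h1 h2 ?_).trans_lt (by rw [hρd]; linarith))
    rw [abs_le] at h3 h4 ⊢
    exact ⟨by linarith, by linarith⟩
  have hD2 : ∀ P ∈ B2, dH (f P) P ≤ D := by
    rintro P ⟨h1, h2, h3⟩
    have h4 := hxy _ _ h1 h2
    refine hD P ((box_ball hρ h1 h2 ?_).trans_lt (by rw [hρd]; linarith))
    rw [abs_le] at h3 h4 ⊢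
    exact ⟨by linarith, by linarith⟩
  have hs1 : {P : H | dH HO P < ρ} ⊆ B1 := by
    intro P hP
    obtain ⟨h1, h2, h3⟩ := ball_box hP
    refine ⟨h1, h2, ?_⟩
    have h4 := hxy _ _ h2 h1
    rw [abs_le] at h3 h4 ⊢
    exact ⟨by linarith, by linarith⟩
  have hs2 : {P : H | dH HO P < ρ} ⊆ B2 := by
    intro P hP
    obtain ⟨h1, h2, h3⟩ := ball_box hP
    refine ⟨h1, h2, ?_⟩
    have h4 := hxy _ _ h1 h2
    rw [abs_le] at h3 h4 ⊢
    exact ⟨by linarith, by linarith⟩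
  obtain ⟨i1, b1⟩ := main_dir hε hf hm hJ (u := 1) (v := 0) (by norm_num) _ (mp_shear 2)
    (fun w => (0, w.1, w.2)) (by intro w s; simp [Hmul]; ring) hρ B1 hB1
    (by
      ext ⟨⟨y, t⟩, s⟩
      simp only [B1, Set.mem_preimage, Set.mem_ofPred_eq, Set.mem_prod, Set.mem_Icc, abs_le,
        add_sub_cancel_right]
      tauto) hD1 (κ / 4 + 3 * ε / (2 * κ)) κ⁻¹ (by positivity)
  obtain ⟨i2, b2⟩ := main_dir hε hf hm hJ (u := 0) (v := 1) (by norm_num) _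
    (mp_perm.comp (mp_shear (-2)))
    (fun w => (w.1, 0, w.2)) (by intro w s; simp [Hmul]) hρ B2 hB2
    (by
      ext ⟨⟨y, t⟩, s⟩
      simp only [B2, Set.mem_preimage, Set.mem_ofPred_eq, Set.mem_prod, Set.mem_Icc, abs_le,
        Function.comp, neg_mul, neg_add_cancel_right]
      tauto) hD2 (κ / 4 + 3 * ε / (2 * κ)) κ⁻¹ (by positivity)
  have hpt : ∀ᵐ P : H, 0 ≤ κ / 4 + 3 * ε / (2 * κ) + κ⁻¹ * (1 - qf (J P) 1 0) ∧
      0 ≤ κ / 4 + 3 * ε / (2 * κ) + κ⁻¹ * (1 - qf (J P) 0 1) ∧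
      matOpNorm (J P - 1) ≤ (κ / 4 + 3 * ε / (2 * κ) + κ⁻¹ * (1 - qf (J P) 1 0)) +
        (κ / 4 + 3 * ε / (2 * κ) + κ⁻¹ * (1 - qf (J P) 0 1)) := by
    filter_upwards [hJ] with P hP
    have c1 := col_bound hε hf hP (u := 1) (v := 0) (by norm_num)
    have c2 := col_bound hε hf hP (u := 0) (v := 1) (by norm_num)
    have q1 : qf (J P) 1 0 = J P 0 0 := by simp [qf]
    have q2 : qf (J P) 0 1 = J P 1 1 := by simp [qf]
    rw [q1, q2]
    simp only [mul_one, mul_zero, add_zero, zero_add] at c1 c2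
    have f1 : (J P 0 0 - 1) ^ 2 + J P 1 0 ^ 2 ≤ 3 * ε + 2 * (1 - J P 0 0) := by nlinarith
    have f2 : J P 0 1 ^ 2 + (J P 1 1 - 1) ^ 2 ≤ 3 * ε + 2 * (1 - J P 1 1) := by nlinarith
    have g1 : ∀ x : ℝ, κ / 4 + 3 * ε / (2 * κ) + κ⁻¹ * (1 - x) =
        κ / 4 + (3 * ε + 2 * (1 - x)) / (2 * κ) := by intro x; field_simp; ring
    rw [g1, g1]
    have f1' : 0 ≤ 3 * ε + 2 * (1 - J P 0 0) := le_trans (by positivity) f1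
    have f2' : 0 ≤ 3 * ε + 2 * (1 - J P 1 1) := le_trans (by positivity) f2
    refine ⟨by positivity, by positivity, ?_⟩
    have m1 := matOpNorm_le (J P - 1)
    have m2 : √((J P - 1) 0 0 ^ 2 + (J P - 1) 0 1 ^ 2 + (J P - 1) 1 0 ^ 2 + (J P - 1) 1 1 ^ 2) ≤
        √((3 * ε + 2 * (1 - J P 0 0)) + (3 * ε + 2 * (1 - J P 1 1))) := by
      apply Real.sqrt_le_sqrt
      simp only [Matrix.sub_apply, Matrix.one_apply]
      norm_num
      linarith
    have m3 := sqrt_amgm (add_nonneg f1' f2') hκ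
    rw [add_div] at m3
    linarith
  calc _ ≤ ∫ P in {P : H | dH HO P < ρ},
        ((κ / 4 + 3 * ε / (2 * κ) + κ⁻¹ * (1 - qf (J P) 1 0)) +
        (κ / 4 + 3 * ε / (2 * κ) + κ⁻¹ * (1 - qf (J P) 0 1))) := by
        refine integral_mono_of_nonneg (Filter.Eventually.of_forall fun P => matOpNorm_nonneg _)
          ((i1.mono_set hs1).add (i2.mono_set hs2)) ?_
        refine ae_restrict_of_ae ?_
        filter_upwards [hpt] with P hP using hP.2.2
    _ = (∫ P in {P : H | dH HO P < ρ}, (κ / 4 + 3 * ε / (2 * κ) + κ⁻¹ * (1 - qf (J P) 1 0))) +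
        ∫ P in {P : H | dH HO P < ρ}, (κ / 4 + 3 * ε / (2 * κ) + κ⁻¹ * (1 - qf (J P) 0 1)) :=
        integral_add (i1.mono_set hs1) (i2.mono_set hs2)
    _ ≤ _ := by
        have e1 := setIntegral_mono_set i1 (ae_restrict_of_ae
          (by filter_upwards [hpt] with P hP using hP.1)) hs1.eventuallyLE
        have e2 := setIntegral_mono_set i2 (ae_restrict_of_ae
          (by filter_upwards [hpt] with P hP using hP.2.1)) hs2.eventuallyLE
        linarith

/-- integral approximation of the Pansu Jacobian.
There are universal constants `C > 0` and `ε₀ > 0` such that: if `f` is a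
`(1+ε)`-biLipschitz self map of `ℍ` with `ε ≤ ε₀` and `f(O) = O`, and for some
`r > 0`, `k ∈ ℕ` one has `d(f(z;t),(z;t)) ≤ C ε^{1/2^k} r` on `B(O,r)`, then
`∫_{B(O,C⁻¹r)} ‖Jf − I‖ ≤ C ε^{1/2^{k+1}} r⁴`. -/
theorem statement7 :
    ∃ C > (0:ℝ), ∃ ε₀ > (0:ℝ),
      ∀ ε : ℝ, 0 ≤ ε → ε ≤ ε₀ →
      ∀ f : H → H, IsBiLip ε f → f HO = HO →
      ∀ Jf : H → Matrix (Fin 2) (Fin 2) ℝ,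
        (∀ i j : Fin 2, Measurable fun P : H => Jf P i j) →
        (∀ᵐ P ∂volume, HasPansuJacobianAt f (Jf P) P) →
      ∀ r : ℝ, 0 < r → ∀ k : ℕ,
        (∀ P : H, dH HO P < r → dH (f P) P ≤ C * ε ^ ((1:ℝ) / 2 ^ k) * r) →
        ∫ P in {P : H | dH HO P < C⁻¹ * r}, matOpNorm (Jf P - 1)
          ≤ C * ε ^ ((1:ℝ) / 2 ^ (k + 1)) * r ^ 4 := by
  refine ⟨100, by norm_num, 1, one_pos, ?_⟩
  intro ε hε hε1 f hf _ Jf hm hJ r hr k hD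
  set θ := ε ^ ((1:ℝ) / 2 ^ (k + 1)) with hθ
  have hθ0 : 0 ≤ θ := Real.rpow_nonneg hε _
  have hη : ε ^ ((1:ℝ) / 2 ^ k) = θ ^ 2 := by
    rw [hθ, ← Real.rpow_natCast (ε ^ ((1:ℝ) / 2 ^ (k + 1))) 2, ← Real.rpow_mul hε]
    congr 1
    rw [pow_succ]; field_simp; norm_num
  have hεη : ε ≤ θ ^ 2 := by
    rw [← hη]
    have h1 : (1:ℝ) / 2 ^ k ≤ 1 := by
      rw [div_le_one (by positivity)]; exact one_le_pow₀ (by norm_num)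
    have := Real.rpow_le_rpow_of_exponent_ge' hε hε1 (by positivity) h1
    rwa [Real.rpow_one] at this
  rw [hη] at hD
  have key := fun κ (hκ : 0 < κ) => core hε hε1 hf hm hJ hr hD (κ := κ) hκ
  have bound : ∀ κ > 0, ∫ P in {P : H | dH HO P < (100:ℝ)⁻¹ * r}, matOpNorm (Jf P - 1) ≤
      r ^ 4 * (κ + θ ^ 2 / κ) := by
    intro κ hκ
    refine (key κ hκ).trans ?_
    have h1 : 3 * ε / (2 * κ) ≤ 3 * θ ^ 2 / (2 * κ) := by gcongr
    calc _ ≤ 48 * (r / 100) ^ 3 * (2 * (r / 100) * (κ / 4 + 3 * θ ^ 2 / (2 * κ)) +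
          κ⁻¹ * (2 * (100 * θ ^ 2 * r))) := by gcongr
      _ = r ^ 4 * ((24 / 100 ^ 4) * κ + (144 / 100 ^ 4 + 9600 / 100 ^ 3) * (θ ^ 2 / κ)) := by
          field_simp; ring
      _ ≤ r ^ 4 * (1 * κ + 1 * (θ ^ 2 / κ)) := by gcongr <;> norm_num
      _ = _ := by ring
  rcases hθ0.eq_or_lt with h0 | h0
  · rw [← h0] at bound ⊢
    simp only [mul_zero, zero_mul]
    refine le_of_forall_pos_le_add fun δ hδ => ?_
    have := bound (δ / r ^ 4) (by positivity)
    refine this.trans (le_of_eq ?_)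
    field_simp
    ring
  · refine (bound θ h0).trans ?_
    have : θ ^ 2 / θ = θ := by field_simp
    rw [this]
    nlinarith [mul_pos h0 (pow_pos hr 4)]
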